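/- arXiv:1709.08770 — 3 statements merged into one kernel-verified Lean document; each statement's English description precedes it below -/
import Mathlib

section
/- Let I, J, T ≥ 1 be natural numbers; let φ : Fin I × Fin T → ℝ and ψ : Fin J × Fin T → ℝ be nonnegative arrays satisfying the l1-constraints ∑_{i} φ_{i,k} = 1 and ∑_{j} ψ_{j,k} = 1 for every k; let λ : Fin T → ℝ be nonnegative. For each pair (i,j) let m_{i,j} ∈ ℕ and let z_{i,j} : Fin m_{i,j} → Fin T be an assignment; define m_{i,j,k} = #{s : z_{i,j}(s) = k}, m_{i,·,k} = ∑_j m_{i,j,k}, m_{·,j,k} = ∑_i m_{i,j,k}, m_{·,·,k} = ∑_i ∑_j m_{i,j,k}, and μ_{i,j} = ∑_{k} φ_{i,k} ψ_{j,k} λ_k, assumed positive whenever m_{i,j} > 0. Then ∏_{i,j} [ (μ_{i,j}^{m_{i,j}} e^{-μ_{i,j}} / m_{i,j}!) · ∏_{s=1}^{m_{i,j}} (φ_{i,z_{i,j}(s)} ψ_{j,z_{i,j}(s)} λ_{z_{i,j}(s)} / μ_{i,j}) ] = ∏_{i,j} (1/m_{i,j}!) · ∏_{i,k} φ_{i,k}^{m_{i,·,k}}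 · ∏_{j,k} ψ_{j,k}^{m_{·,j,k}} · ∏_{k} λ_k^{m_{·,·,k}} e^{-λ_k}. (Lemma 1 of the paper: the joint likelihood of counts and assignments in the DEPM fully factorizes.) -/
open Nat Finset

/-- The likelihood of a Poisson count together with its i.i.d. atom assignments, for unnormalized
atom weights `w` of total mass `μ`. -/
theorem poisson_mul_prod_assignment {κ : Type*} [Fintype κ] [DecidableEq κ] (n : ℕ)
    (z : Fin n → κ) (w : κ → ℝ) (μ : ℝ) (hμ : 0 < n → μ ≠ 0) :
    μ ^ n * Real.exp (-μ) / (n ! : ℝ) * ∏ s, (w (z s) / μ)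
      = 1 / (n ! : ℝ) * Real.exp (-μ) * ∏ k, w k ^ (univ.filter (fun s => z s = k)).card := by
  have hfiber : ∏ s, w (z s) = ∏ k, w k ^ (univ.filter (fun s => z s = k)).card := by
    simpa using Finset.prod_comp (s := univ) w z |>.trans
      (Finset.prod_subset (subset_univ _) fun k _ hk => by
        rw [Finset.card_eq_zero.2, pow_zero]
        exact filter_eq_empty_iff.2 fun s _ hs => hk (hs ▸ mem_image_of_mem z (mem_univ s)))
  have hpow : μ ^ n ≠ 0 := by
    rcases Nat.eq_zero_or_pos n with rfl | hn
    · simp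
    · exact pow_ne_zero _ (hμ hn)
  rw [prod_div_distrib, hfiber, prod_const, Finset.card_univ, Fintype.card_fin]
  field_simp

/-- Lemma 1 of the paper: under the l1-constraints `∑ i, phi i k = 1` and `∑ j, psi j k = 1`,
the joint likelihood of the DEPM's counts and assignments fully factorizes. -/
theorem depm_joint_likelihood_factorizes
    (I J T : ℕ) (hI : 1 ≤ I) (hJ : 1 ≤ J) (hT : 1 ≤ T)
    (phi : Fin I → Fin T → ℝ) (psi : Fin J → Fin T → ℝ) (lam : Fin T → ℝ)
    (hphi : ∀ i k, 0 ≤ phi i k) (hpsi : ∀ j k, 0 ≤ psi j k) (hlam : ∀ k, 0 ≤ lam k)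
    (hphisum : ∀ k, ∑ i, phi i k = 1) (hpsisum : ∀ k, ∑ j, psi j k = 1)
    (m : Fin I → Fin J → ℕ) (z : ∀ i j, Fin (m i j) → Fin T)
    (μ : Fin I → Fin J → ℝ)
    (hμ : ∀ i j, μ i j = ∑ k, phi i k * psi j k * lam k)
    (hμpos : ∀ i j, 0 < m i j → 0 < μ i j)
    (mc : Fin I → Fin J → Fin T → ℕ)
    (hmc : ∀ i j k, mc i j k = (Finset.univ.filter (fun s => z i j s = k)).card) :
    ∏ i, ∏ j, ((μ i j) ^ (m i j) * Real.exp (-(μ i j)) / (m i j)! *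
        ∏ s, (phi i (z i j s) * psi j (z i j s) * lam (z i j s) / μ i j))
      = (∏ i, ∏ j, (1 : ℝ) / (m i j)!) *
        (∏ i, ∏ k, phi i k ^ (∑ j, mc i j k)) *
        (∏ j, ∏ k, psi j k ^ (∑ i, mc i j k)) *
        ∏ k, lam k ^ (∑ i, ∑ j, mc i j k) * Real.exp (-(lam k)) := by
  have hexp : ∏ i, ∏ j, Real.exp (-(μ i j)) = ∏ k, Real.exp (-(lam k)) := by
    have hsum : ∑ i, ∑ j, μ i j = ∑ k, lam k := by
      simp_rw [hμ, sum_comm (s := (univ : Finset (Fin J)))]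
      rw [sum_comm]
      refine sum_congr rfl fun k _ => ?_
      simp_rw [← sum_mul, ← mul_sum, hpsisum, mul_one, hphisum, one_mul]
    simp_rw [← Real.exp_sum, sum_neg_distrib, hsum]
  have hphiprod : ∏ i, ∏ j, ∏ k, phi i k ^ mc i j k = ∏ i, ∏ k, phi i k ^ (∑ j, mc i j k) := by
    refine prod_congr rfl fun i _ => ?_
    rw [prod_comm]
    simp_rw [prod_pow_eq_pow_sum]
  have hpsiprod : ∏ i, ∏ j, ∏ k, psi j k ^ mc i j k = ∏ j, ∏ k, psi j k ^ (∑ i, mc i j k) := by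
    rw [prod_comm]
    refine prod_congr rfl fun j _ => ?_
    rw [prod_comm]
    simp_rw [prod_pow_eq_pow_sum]
  have hlamprod : ∏ i, ∏ j, ∏ k, lam k ^ mc i j k = ∏ k, lam k ^ (∑ i, ∑ j, mc i j k) := by
    simp_rw [prod_comm (s := (univ : Finset (Fin J))), prod_pow_eq_pow_sum]
    rw [prod_comm]
    simp_rw [prod_pow_eq_pow_sum]
  have hentry (i : Fin I) (j : Fin J) :=
    poisson_mul_prod_assignment (m i j) (z i j) (fun k => phi i k * psi j k * lam k) (μ i j)
      fun h => (hμpos i j h).ne'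
  simp_rw [hentry, ← hmc, mul_pow, prod_mul_distrib, hexp, hphiprod, hpsiprod, hlamprod]
  ring
end

section
/- Let γ0 > 0, let K ≥ 0 be a natural number, and let m : Fin K → ℕ with m_k ≥ 1 for every k. Then the limit as T → ∞ (over natural numbers T ≥ K) of (T!/(T−K)!) · ∏_{k} Γ(γ0/T + m_k)/Γ(γ0/T) equals γ0^K · ∏_k Γ(m_k) = γ0^K · ∏_k (m_k − 1)!. -/
open Nat Filter Finset

theorem Nat.tendsto_descFactorial_div_pow (K : ℕ) :
    Tendsto (fun T : ℕ => (T.descFactorial K : ℝ) / (T : ℝ) ^ K) atTop (nhds 1) := by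
  refine (Asymptotics.isEquivalent_iff_tendsto_one ?_).mp (isEquivalent_descFactorial K)
  filter_upwards [eventually_gt_atTop 0] with T hT
  positivity

theorem Real.tendsto_nat_mul_Gamma_div_add_nat_div_Gamma_div {a : ℝ} (ha : 0 < a) {n : ℕ}
    (hn : 1 ≤ n) :
    Tendsto (fun T : ℕ => (T : ℝ) * (Real.Gamma (a / T + n) / Real.Gamma (a / T)))
      atTop (nhds (a * Real.Gamma n)) := by
  have hcont (p : ℕ) (hp : 1 ≤ p) :
      Tendsto (fun T : ℕ => Real.Gamma (a / T + p)) atTop (nhds (Real.Gamma p)) := by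
    have hp' : (0 : ℝ) < p := by exact_mod_cast hp
    have h : Tendsto (fun T : ℕ => a / (T : ℝ) + p) atTop (nhds p) := by
      simpa using (tendsto_const_div_atTop_nhds_zero_nat a).add_const (p : ℝ)
    refine (Real.differentiableAt_Gamma fun q => ?_).continuousAt.tendsto.comp h
    have : (0 : ℝ) ≤ q := q.cast_nonneg
    linarith
  have hlim := ((hcont n hn).const_mul a).div (hcont 1 le_rfl) (by simp)
  simp only [Nat.cast_one, Real.Gamma_one, div_one] at hlim
  refine hlim.congr' ?_
  filter_upwards [eventually_gt_atTop 0] with T hT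
  have hT' : (0 : ℝ) < T := by exact_mod_cast hT
  have haT : 0 < a / T := by positivity
  have hG := (Real.Gamma_pos_of_pos haT).ne'
  simp only [Pi.div_apply]
  rw [Real.Gamma_add_one haT.ne']
  generalize Real.Gamma (a / T) = g at *
  field_simp

/-- Core limit in the proof of Theorem 4 of the paper: for `γ0 > 0` and positive counts
`m k ≥ 1`, `(T!/(T-K)!) · ∏ k, Γ(γ0/T + m k)/Γ(γ0/T) → γ0^K · ∏ k, Γ(m k) = γ0^K · ∏ k, (m k - 1)!`
as the truncation level `T → ∞`. -/
theorem partition_gamma_ratio_limit (γ0 : ℝ) (hγ0 : 0 < γ0) (K : ℕ)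
    (m : Fin K → ℕ) (hm : ∀ k, 1 ≤ m k) :
    Tendsto (fun T : ℕ =>
        ((T)! / ((T - K)! : ℝ)) * ∏ k, Real.Gamma (γ0 / T + m k) / Real.Gamma (γ0 / T))
        atTop (nhds (γ0 ^ K * ∏ k, Real.Gamma (m k))) ∧
      γ0 ^ K * ∏ k, Real.Gamma (m k) = γ0 ^ K * ∏ k, ((m k - 1)! : ℝ) := by
  constructor
  · have hprod := tendsto_finsetProd univ fun k (_ : k ∈ univ) =>
      Real.tendsto_nat_mul_Gamma_div_add_nat_div_Gamma_div hγ0 (hm k)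
    have hlim := (Nat.tendsto_descFactorial_div_pow K).mul hprod
    simp only [prod_mul_distrib, prod_const, Finset.card_univ, Fintype.card_fin, one_mul] at hlim
    refine hlim.congr' ?_
    filter_upwards [eventually_gt_atTop 0, eventually_ge_atTop K] with T hT hKT
    have hT' : (T : ℝ) ≠ 0 := by positivity
    have hfact : (T.descFactorial K : ℝ) = (T)! / ((T - K)! : ℝ) := by
      rw [eq_div_iff (by positivity), mul_comm]
      exact_mod_cast Nat.factorial_mul_descFactorial hKT
    rw [← hfact, ← mul_assoc, div_mul_cancel₀ _ (pow_ne_zero K hT')]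
  · congr 1
    refine prod_congr rfl fun k _ => ?_
    rw [← Real.Gamma_nat_eq_factorial, Nat.cast_sub (hm k), Nat.cast_one, sub_add_cancel]
end

section
/- Let I, J ≥ 1 and K ≥ 0 be natural numbers, α1, α2, γ0, c0 > 0 reals, and let m : Fin I × Fin J × Fin K → ℕ be counts with m_{·,·,k} = ∑_{i,j} m_{i,j,k} ≥ 1 for every k < K; write m_{i,j,·} = ∑_k m_{i,j,k}, m_{i,·,k} = ∑_j m_{i,j,k}, m_{·,j,k} = ∑_i m_{i,j,k}. For a truncation level T ≥ K define P(T) = ∏_{i,j} (1/m_{i,j,·}!) · ∏_{k<K} [Γ(Iα1)/Γ(Iα1 + m_{·,·,k}) · ∏_i Γ(α1 + m_{i,·,k})/Γ(α1)] · ∏_{k<K} [Γ(Jα2)/Γ(Jα2 + m_{·,·,k}) · ∏_j Γ(α2 + m_{·,j,k})/Γ(α2)] · ∏_{k<K} [Γ(γ0/T + m_{·,·,k}) c0^{γ0/T} / (Γ(γ0/T) (c0+1)^{γ0/T + m_{·,·,k}})] · [c0^{γ0/T}/(c0+1)^{γ0/T}]^{T−K} (the truncated DEPM marginal likelihood in which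 the remaining T − K atoms carry zero counts). Then lim_{T→∞} (T!/(T−K)!) · P(T) = ∏_{i,j} (1/m_{i,j,·}!) · ∏_{k<K} [Γ(Iα1)/Γ(Iα1 + m_{·,·,k}) · ∏_i Γ(α1 + m_{i,·,k})/Γ(α1)] · ∏_{k<K} [Γ(Jα2)/Γ(Jα2 + m_{·,·,k}) · ∏_j Γ(α2 + m_{·,j,k})/Γ(α2)] · γ0^K · (c0/(c0+1))^{γ0} · ∏_{k<K} Γ(m_{·,·,k})/(c0+1)^{m_{·,·,k}}. (Theorem 4 of the paper: the marginal likelihood of the truly infinite DEPM.) -/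
open Nat Filter Finset

/-- `T! / (T - K)!` grows like `T ^ K`. -/
theorem tendsto_factorial_div_factorial_sub_div_pow (K : ℕ) :
    Tendsto (fun T : ℕ => ((T)! / ((T - K)! : ℝ)) / (T : ℝ) ^ K) atTop (nhds 1) := by
  have hequiv : Tendsto (fun T : ℕ => (T.descFactorial K : ℝ) / (T : ℝ) ^ K) atTop (nhds 1) := by
    induction K with
    | zero => simp
    | succ K ih =>
      have h : Tendsto (fun T : ℕ => 1 - (K : ℝ) / (T : ℝ)) atTop (nhds 1) := by
        simpa using tendsto_const_nhds.sub (tendsto_const_div_atTop_nhds_zero_nat (K : ℝ))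
      have := h.mul ih
      rw [mul_one] at this
      refine this.congr' ?_
      filter_upwards [eventually_ge_atTop (K + 1)] with T hT
      have hT0 : (T : ℝ) ≠ 0 := by norm_cast; omega
      rw [Nat.descFactorial_succ, Nat.cast_mul, Nat.cast_sub (by omega)]
      field_simp
      ring
  refine hequiv.congr' ?_
  filter_upwards [eventually_ge_atTop K] with T hT
  congr 1
  rw [eq_div_iff (by positivity), mul_comm]
  exact_mod_cast Nat.factorial_mul_descFactorial hT

/-- The contribution of one occupied atom, with the vanishing factor `x` of `1 / Γ x` and the
factor shared with the empty atoms pulled out. -/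
theorem Gamma_add_nat_mul_rpow_div {x c : ℝ} (hx : x ≠ 0) (hc : 0 < c) (n : ℕ) :
    Real.Gamma (x + n) * c ^ x / (Real.Gamma x * (c + 1) ^ (x + n)) =
      x * (c ^ x / (c + 1) ^ x) *
        (Real.Gamma (x + n) / Real.Gamma (x + 1) / (c + 1) ^ n) := by
  rw [Real.Gamma_add_one hx, Real.rpow_add_natCast (by positivity)]
  field_simp

/-- The factor contributed by one empty atom, raised to the number of atoms, is independent of
the truncation level. -/
theorem rpow_div_rpow_pow {c γ : ℝ} (hc : 0 < c) {T : ℕ} (hT : T ≠ 0) :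
    (c ^ (γ / T) / (c + 1) ^ (γ / T)) ^ T = (c / (c + 1)) ^ γ := by
  rw [← Real.div_rpow hc.le (by positivity), ← Real.rpow_mul_natCast (by positivity),
    div_mul_cancel₀ γ (Nat.cast_ne_zero.mpr hT)]

/-- Limit of the part of the truncated marginal likelihood that depends on the truncation
level. -/
theorem tendsto_atom_weights {K : ℕ} {γ0 c0 : ℝ} (hγ0 : 0 < γ0) (hc0 : 0 < c0)
    (n : Fin K → ℕ) (hn : ∀ k, 1 ≤ n k) :
    Tendsto (fun T : ℕ => ((T)! / ((T - K)! : ℝ)) *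
        ((∏ k, Real.Gamma (γ0 / T + n k) * c0 ^ (γ0 / T) /
          (Real.Gamma (γ0 / T) * (c0 + 1) ^ (γ0 / T + n k))) *
        (c0 ^ (γ0 / T) / (c0 + 1) ^ (γ0 / T)) ^ (T - K)))
      atTop
      (nhds (γ0 ^ K * (c0 / (c0 + 1)) ^ γ0 *
        ∏ k, Real.Gamma (n k) / (c0 + 1) ^ n k)) := by
  have hzero := tendsto_const_div_atTop_nhds_zero_nat γ0
  have hGamma {s : ℝ} (hs : 0 < s) :
      Tendsto (fun T : ℕ => Real.Gamma (γ0 / T + s)) atTop (nhds (Real.Gamma s)) := by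
    have hcont : ContinuousAt Real.Gamma s := (Real.differentiableAt_Gamma fun j => by
      have : (0 : ℝ) ≤ j := j.cast_nonneg
      linarith).continuousAt
    refine hcont.tendsto.comp ?_
    simpa using hzero.add_const s
  have hprod : Tendsto (fun T : ℕ => ∏ k, Real.Gamma (γ0 / T + n k) / Real.Gamma (γ0 / T + 1) /
      (c0 + 1) ^ n k) atTop (nhds (∏ k, Real.Gamma (n k) / (c0 + 1) ^ n k)) := by
    refine tendsto_finsetProd _ fun k _ => ?_
    have h := (hGamma (Nat.cast_pos.mpr (hn k))).div (hGamma one_pos) (by simp)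
    simpa using h.div_const ((c0 + 1) ^ n k)
  have hlim := (tendsto_factorial_div_factorial_sub_div_pow K).mul
    (hprod.const_mul (γ0 ^ K * (c0 / (c0 + 1)) ^ γ0))
  rw [one_mul] at hlim
  refine hlim.congr' ?_
  filter_upwards [eventually_ge_atTop (K + 1)] with T hT
  have hT0 : (T : ℝ) ≠ 0 := by norm_cast; omega
  simp_rw [Gamma_add_nat_mul_rpow_div (div_ne_zero hγ0.ne' hT0) hc0]
  rw [Finset.prod_mul_distrib, Finset.prod_const, Finset.card_univ, Fintype.card_fin,
    ← rpow_div_rpow_pow (γ := γ0) hc0 (T := T) (by omega), mul_pow, div_pow γ0]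
  generalize c0 ^ (γ0 / T) / (c0 + 1) ^ (γ0 / T) = r
  rw [← pow_mul_pow_sub r (show K ≤ T by omega)]
  ring

/-- Theorem 4 of the paper: the marginal likelihood of the truly infinite DEPM (IDEPM) is the
limit, as the truncation level `T → ∞`, of `(T!/(T-K)!)` times the truncated DEPM marginal
likelihood in which the `K` active atoms carry the counts `m` and the remaining `T - K` atoms
carry zero counts. -/
theorem idepm_marginal_likelihood
    (I J K : ℕ) (hI : 1 ≤ I) (hJ : 1 ≤ J)
    (α1 α2 γ0 c0 : ℝ) (hα1 : 0 < α1) (hα2 : 0 < α2) (hγ0 : 0 < γ0) (hc0 : 0 < c0)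
    (m : Fin I → Fin J → Fin K → ℕ)
    (hm : ∀ k, 1 ≤ ∑ i, ∑ j, m i j k) :
    Tendsto (fun T : ℕ =>
        ((T)! / ((T - K)! : ℝ)) *
          ((∏ i, ∏ j, (1 : ℝ) / (∑ k, m i j k)!) *
            (∏ k, (Real.Gamma (I * α1) / Real.Gamma (I * α1 + ∑ i, ∑ j, m i j k)) *
              ∏ i, Real.Gamma (α1 + ∑ j, m i j k) / Real.Gamma α1) *
            (∏ k, (Real.Gamma (J * α2) / Real.Gamma (J * α2 + ∑ i, ∑ j, m i j k)) *
              ∏ j, Real.Gamma (α2 + ∑ i, m i j k) / Real.Gamma α2) *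
            (∏ k, Real.Gamma (γ0 / T + ∑ i, ∑ j, m i j k) * c0 ^ (γ0 / T) /
              (Real.Gamma (γ0 / T) * (c0 + 1) ^ (γ0 / T + (∑ i, ∑ j, m i j k : ℕ)))) *
            (c0 ^ (γ0 / T) / (c0 + 1) ^ (γ0 / T)) ^ (T - K)))
      atTop
      (nhds
        ((∏ i, ∏ j, (1 : ℝ) / (∑ k, m i j k)!) *
          (∏ k, (Real.Gamma (I * α1) / Real.Gamma (I * α1 + ∑ i, ∑ j, m i j k)) *
            ∏ i, Real.Gamma (α1 + ∑ j, m i j k) / Real.Gamma α1) *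
          (∏ k, (Real.Gamma (J * α2) / Real.Gamma (J * α2 + ∑ i, ∑ j, m i j k)) *
            ∏ j, Real.Gamma (α2 + ∑ i, m i j k) / Real.Gamma α2) *
          (γ0 ^ K * (c0 / (c0 + 1)) ^ γ0 *
            ∏ k, Real.Gamma (∑ i, ∑ j, m i j k) / (c0 + 1) ^ (∑ i, ∑ j, m i j k)))) := by
  have h := (tendsto_atom_weights hγ0 hc0 (fun k => ∑ i, ∑ j, m i j k) hm).const_mul
    ((∏ i, ∏ j, (1 : ℝ) / (∑ k, m i j k)!) *
      (∏ k, (Real.Gamma (I * α1) / Real.Gamma (I * α1 + ∑ i, ∑ j, m i j k)) *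
        ∏ i, Real.Gamma (α1 + ∑ j, m i j k) / Real.Gamma α1) *
      (∏ k, (Real.Gamma (J * α2) / Real.Gamma (J * α2 + ∑ i, ∑ j, m i j k)) *
        ∏ j, Real.Gamma (α2 + ∑ i, m i j k) / Real.Gamma α2))
  push_cast at h ⊢
  refine h.congr fun T => ?_
  ring
end
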